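/- Let (X, μ) be a measure space with 0 < μ(X) < ∞, let n ≥ 1 be an integer, let C ≥ 0, and let v : X → ℝ be integrable with v ≥ 0. Set B := (1/μ(X)) ∫_X v dμ and assume B > 0. Suppose that α := μ({v > 0})/μ(X) ≤ 1/2 and that pointwise on the set {v > 0} one has v ≤ (3/2)^{1/(n+1)} · B^{1/(n+1)} · (C + (3/2)B)^{n/(n+1)}. Then B ≤ 4C. -/

import Mathlib

open Real MeasureTheory

/-- The weighted geometric mean of `a` and `C + a`, with weights `1 / (n + 1)` and `n / (n + 1)`,
is at most `C + a`. -/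
theorem rpow_mul_rpow_le_add (n : ℕ) {a C : ℝ} (ha : 0 < a) (hC : 0 ≤ C) :
    a ^ ((1 : ℝ) / ((n : ℝ) + 1)) * (C + a) ^ ((n : ℝ) / ((n : ℝ) + 1)) ≤ C + a := by
  have hK : 0 < C + a := by linarith
  calc a ^ ((1 : ℝ) / ((n : ℝ) + 1)) * (C + a) ^ ((n : ℝ) / ((n : ℝ) + 1))
      ≤ (C + a) ^ ((1 : ℝ) / ((n : ℝ) + 1)) * (C + a) ^ ((n : ℝ) / ((n : ℝ) + 1)) := by
        gcongr
        linarith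
    _ = C + a := by
        rw [← Real.rpow_add hK, ← add_div, add_comm (1 : ℝ), div_self (by positivity), Real.rpow_one]

/-- The integral of a nonnegative function bounded by `K` where it is positive. -/
theorem integral_le_mul_measure_pos {X : Type*} [MeasurableSpace X] {μ : Measure X}
    [IsFiniteMeasure μ] {v : X → ℝ} (hv : ∀ x, 0 ≤ v x) {K : ℝ} (hK : ∀ x, 0 < v x → v x ≤ K) :
    ∫ x, v x ∂μ ≤ K * (μ {x | 0 < v x}).toReal := by
  rw [← setIntegral_eq_integral_of_forall_compl_eq_zero (s := {x | 0 < v x})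
    fun x hx => le_antisymm (not_lt.mp hx) (hv x)]
  refine (Real.le_norm_self _).trans
    (norm_setIntegral_le_of_norm_le_const (measure_lt_top μ _) fun x hx => ?_)
  rw [Real.norm_of_nonneg (hv x)]
  exact hK x hx

/-- Integration and iteration steps of the uniform `L∞` estimate. -/
theorem stmt5 {X : Type*} [MeasurableSpace X] (μ : Measure X)
    (hμ0 : 0 < μ Set.univ) (hμfin : μ Set.univ < ⊤)
    (n : ℕ) (hn : 1 ≤ n) (C : ℝ) (hC : 0 ≤ C)
    (v : X → ℝ) (hint : Integrable v μ) (hv : ∀ x, 0 ≤ v x)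
    (B : ℝ) (hB : B = (1 / (μ Set.univ).toReal) * ∫ x, v x ∂μ) (hBpos : 0 < B)
    (hα : (μ {x | 0 < v x}).toReal / (μ Set.univ).toReal ≤ 1/2)
    (hpt : ∀ x, 0 < v x →
      v x ≤ ((3 : ℝ)/2) ^ ((1 : ℝ)/((n : ℝ) + 1)) * B ^ ((1 : ℝ)/((n : ℝ) + 1))
              * (C + (3/2) * B) ^ ((n : ℝ)/((n : ℝ) + 1))) :
    B ≤ 4 * C := by
  have : IsFiniteMeasure μ := ⟨hμfin⟩
  have hm : 0 < (μ Set.univ).toReal := ENNReal.toReal_pos hμ0.ne' hμfin.ne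
  have hbound : ∀ x, 0 < v x → v x ≤ C + 3 / 2 * B := fun x hx => by
    refine (hpt x hx).trans ?_
    rw [← Real.mul_rpow (by norm_num) hBpos.le]
    exact rpow_mul_rpow_le_add n (by positivity) hC
  have hI := integral_le_mul_measure_pos (μ := μ) hv hbound
  have key : B ≤ (C + 3 / 2 * B) * (1 / 2) :=
    calc B = (1 / (μ Set.univ).toReal) * ∫ x, v x ∂μ := hB
      _ ≤ (1 / (μ Set.univ).toReal) * ((C + 3 / 2 * B) * (μ {x | 0 < v x}).toReal) := by gcongr
      _ = (C + 3 / 2 * B) * ((μ {x | 0 < v x}).toReal / (μ Set.univ).toReal) := by ring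
      _ ≤ (C + 3 / 2 * B) * (1 / 2) := by gcongr
  linarith
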